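/- Let f(z) = ((1+z)e^{−z} − 1)/(4π z²) for z > 0, and define Φ : ℝ³ \ {0} → ℝ³ by Φ(x) = f(|x|) x/|x|. Then Φ is twice differentiable on ℝ³ \ {0} and there is a constant C > 0 such that for every x ≠ 0 the norm of its second derivative satisfies ‖D²Φ(x)‖ ≤ C (1 + 1/|x|²). -/

import Mathlib

noncomputable section

abbrev E3 := EuclideanSpace ℝ (Fin 3)

/-- The kernel profile `f(z) = ((1+z)e^{-z} - 1)/(4 π z²)`. -/
def kf (z : ℝ) : ℝ := ((1 + z) * Real.exp (-z) - 1) / (4 * Real.pi * z ^ 2)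

/-- The Biot–Savart-type kernel `Φ(x) = f(|x|) x/|x|` (for `α = 1`). -/
def Phi (x : E3) : E3 := kf ‖x‖ • (‖x‖⁻¹ • x)

section Radial

variable {E G : Type*} [NormedAddCommGroup E] [InnerProductSpace ℝ E]
  [NormedAddCommGroup G] [NormedSpace ℝ G]

theorem hasFDerivAt_norm_of_ne_zero {x : E} (hx : x ≠ 0) :
    HasFDerivAt (fun y : E => ‖y‖) (‖x‖⁻¹ • innerSL ℝ x) x := by
  have hr : ‖x‖ ≠ 0 := norm_ne_zero_iff.2 hx
  have h := (hasStrictFDerivAt_norm_sq x).hasFDerivAt.sqrt (pow_ne_zero 2 hr)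
  simp only [Real.sqrt_sq (norm_nonneg _)] at h
  convert! h using 1
  ext v
  simp
  field_simp

theorem HasDerivAt.hasFDerivAt_comp_norm_smul {h : ℝ → ℝ} {a : ℝ} {F : E → G} {F' : E →L[ℝ] G}
    {x : E} (hx : x ≠ 0) (hh : HasDerivAt h (a * ‖x‖) ‖x‖) (hF : HasFDerivAt F F' x) :
    HasFDerivAt (fun y => h ‖y‖ • F y) (h ‖x‖ • F' + (a • innerSL ℝ x).smulRight (F x)) x := by
  have hr : ‖x‖ ≠ 0 := norm_ne_zero_iff.2 hx
  have h1 : HasFDerivAt (fun y : E => h ‖y‖) (a • innerSL ℝ x) x := by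
    convert! hh.comp_hasFDerivAt x (hasFDerivAt_norm_of_ne_zero hx) using 1
    rw [smul_smul, mul_assoc, mul_inv_cancel₀ hr, mul_one]
  exact h1.smul hF

/-- The first derivative of `y ↦ h ‖y‖ • y`, where `a r` is `deriv h r / r`. -/
def radialFDeriv (h a : ℝ → ℝ) (y : E) : E →L[ℝ] E :=
  h ‖y‖ • ContinuousLinearMap.id ℝ E +
    a ‖y‖ • ContinuousLinearMap.smulRightL ℝ E E (innerSL ℝ y) y

theorem hasFDerivAt_radial {h a : ℝ → ℝ} {x : E} (hx : x ≠ 0)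
    (hh : HasDerivAt h (a ‖x‖ * ‖x‖) ‖x‖) :
    HasFDerivAt (fun y : E => h ‖y‖ • y) (radialFDeriv h a x) x := by
  convert! hh.hasFDerivAt_comp_norm_smul hx (hasFDerivAt_id x) using 1
  ext v
  simp [radialFDeriv, smul_smul]

theorem exists_hasFDerivAt_radialFDeriv {h a : ℝ → ℝ} {b : ℝ} {x : E} (hx : x ≠ 0)
    (hh : HasDerivAt h (a ‖x‖ * ‖x‖) ‖x‖) (ha : HasDerivAt a (b * ‖x‖) ‖x‖) :
    ∃ D : E →L[ℝ] E →L[ℝ] E, HasFDerivAt (radialFDeriv h a) D x ∧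
      ‖D‖ ≤ 3 * |a ‖x‖| * ‖x‖ + |b| * ‖x‖ ^ 3 := by
  have h1 := hh.hasFDerivAt_comp_norm_smul hx
    (hasFDerivAt_const (ContinuousLinearMap.id ℝ E) x)
  have h2 := ha.hasFDerivAt_comp_norm_smul hx
    ((ContinuousLinearMap.smulRightL ℝ E E).hasFDerivAt_of_bilinear
      (innerSL ℝ : E →L[ℝ] E →L[ℝ] ℝ).hasFDerivAt (hasFDerivAt_id x))
  refine ⟨_, h1.add h2, ContinuousLinearMap.opNorm_le_bound _ (by positivity) fun v => ?_⟩
  have hin : |inner ℝ x v| ≤ ‖x‖ * ‖v‖ := abs_real_inner_le_norm x v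
  have hnorm (p q : E) : ‖(innerSL ℝ p).smulRight q‖ = ‖p‖ * ‖q‖ := by
    rw [ContinuousLinearMap.norm_smulRight_apply, innerSL_apply_norm]
  have hid : ‖(a ‖x‖ * inner ℝ x v) • ContinuousLinearMap.id ℝ E‖ ≤
      |a ‖x‖| * (‖x‖ * ‖v‖) := by
    rw [norm_smul, Real.norm_eq_abs, abs_mul, mul_assoc]
    refine mul_le_mul_of_nonneg_left ?_ (abs_nonneg _)
    exact (mul_le_of_le_one_right (abs_nonneg _)
      (ContinuousLinearMap.norm_id_le (𝕜 := ℝ) (E := E))).trans hin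
  have hbil : ‖a ‖x‖ • ((innerSL ℝ x).smulRight v + (innerSL ℝ v).smulRight x)‖ ≤
      |a ‖x‖| * (‖x‖ * ‖v‖ + ‖v‖ * ‖x‖) := by
    rw [norm_smul, Real.norm_eq_abs, ← hnorm x v, ← hnorm v x]
    gcongr
    exact norm_add_le _ _
  have hb : ‖(b * inner ℝ x v) • (innerSL ℝ x).smulRight x‖ ≤
      |b| * (‖x‖ * ‖v‖) * (‖x‖ * ‖x‖) := by
    rw [norm_smul, Real.norm_eq_abs, abs_mul, hnorm]
    gcongr
  refine (norm_add₃_le.trans (add_le_add (add_le_add hid hbil) hb)).trans_eq' ?_ |>.trans_eq ?_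
  · congr 1
    ext w
    simp [add_assoc]
    rfl
  · ring

end Radial

/-- The profile `h` with `Phi x = h ‖x‖ • x`. -/
def kh (r : ℝ) : ℝ := ((1 + r) * Real.exp (-r) - 1) / (4 * Real.pi * r ^ 3)

/-- The quotient `deriv kh r / r`. -/
def ka (r : ℝ) : ℝ :=
  -(r ^ 2 * Real.exp (-r) + 3 * ((1 + r) * Real.exp (-r) - 1)) / (4 * Real.pi * r ^ 5)

/-- The quotient `deriv ka r / r`. -/
def kb (r : ℝ) : ℝ :=
  (r ^ 3 * Real.exp (-r) + 6 * (r ^ 2 * Real.exp (-r)) +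
    15 * ((1 + r) * Real.exp (-r) - 1)) / (4 * Real.pi * r ^ 7)

theorem hasDerivAt_exp_neg (r : ℝ) :
    HasDerivAt (fun s => Real.exp (-s)) (-Real.exp (-r)) r := by
  simpa using (hasDerivAt_neg r).exp

theorem hasDerivAt_one_add_mul_exp_neg (r : ℝ) :
    HasDerivAt (fun s => (1 + s) * Real.exp (-s) - 1) (-(r * Real.exp (-r))) r := by
  convert! ((((hasDerivAt_id r).const_add 1).mul (hasDerivAt_exp_neg r)).sub_const 1) using 1
  simp
  ring

theorem hasDerivAt_kh {r : ℝ} (hr : 0 < r) : HasDerivAt kh (ka r * r) r := by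
  have hpi := Real.pi_pos
  convert! (hasDerivAt_one_add_mul_exp_neg r).div ((hasDerivAt_pow 3 r).const_mul (4 * Real.pi))
    (by positivity) using 1
  simp only [ka]
  push_cast
  field_simp
  ring

theorem hasDerivAt_ka {r : ℝ} (hr : 0 < r) : HasDerivAt ka (kb r * r) r := by
  have hpi := Real.pi_pos
  convert! (((hasDerivAt_pow 2 r).mul (hasDerivAt_exp_neg r)).add
    ((hasDerivAt_one_add_mul_exp_neg r).const_mul 3)).neg.div
    ((hasDerivAt_pow 5 r).const_mul (4 * Real.pi)) (by positivity) using 1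
  simp only [kb, Pi.neg_apply, Pi.add_apply, Pi.mul_apply]
  push_cast
  field_simp
  ring

theorem abs_one_add_mul_exp_neg_sub_one_le {r : ℝ} (hr : 0 ≤ r) :
    |(1 + r) * Real.exp (-r) - 1| ≤ r ^ 2 := by
  have h1 : 1 - r ≤ Real.exp (-r) := by linarith [Real.add_one_le_exp (-r)]
  have h2 : (1 + r) * Real.exp (-r) ≤ 1 := by
    rw [Real.exp_neg, ← div_eq_mul_inv, div_le_one (Real.exp_pos r)]
    linarith [Real.add_one_le_exp r]
  rw [abs_le]
  constructor <;> nlinarith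

theorem abs_ka_le {r : ℝ} (hr : 0 < r) : |ka r| ≤ 4 / r ^ 3 := by
  have hpi := Real.pi_gt_three
  have hN := abs_one_add_mul_exp_neg_sub_one_le hr.le
  have he : Real.exp (-r) ≤ 1 := Real.exp_le_one_iff.2 (by linarith)
  have he0 := Real.exp_pos (-r)
  have hnum : |r ^ 2 * Real.exp (-r) + 3 * ((1 + r) * Real.exp (-r) - 1)| ≤ 4 * r ^ 2 := by
    rw [abs_le] at hN ⊢
    constructor <;> nlinarith [sq_nonneg r, mul_nonneg (sq_nonneg r) he0.le]
  rw [ka, abs_div, abs_neg, abs_of_pos (by positivity : 0 < 4 * Real.pi * r ^ 5),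
    div_le_div_iff₀ (by positivity) (by positivity)]
  calc _ ≤ 4 * r ^ 2 * r ^ 3 := by gcongr
    _ = 4 * (1 * r ^ 5) := by ring
    _ ≤ _ := by gcongr; linarith

theorem abs_kb_le {r : ℝ} (hr : 0 < r) : |kb r| ≤ 22 / r ^ 5 := by
  have hpi := Real.pi_gt_three
  have hN := abs_one_add_mul_exp_neg_sub_one_le hr.le
  have he : Real.exp (-r) ≤ 1 := Real.exp_le_one_iff.2 (by linarith)
  have he0 := Real.exp_pos (-r)
  have hre : r * Real.exp (-r) ≤ 1 := by
    rw [Real.exp_neg, ← div_eq_mul_inv, div_le_one (Real.exp_pos r)]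
    linarith [Real.add_one_le_exp r]
  have hnum : |r ^ 3 * Real.exp (-r) + 6 * (r ^ 2 * Real.exp (-r)) +
      15 * ((1 + r) * Real.exp (-r) - 1)| ≤ 22 * r ^ 2 := by
    have h3 : r ^ 3 * Real.exp (-r) ≤ r ^ 2 := by nlinarith [sq_nonneg r]
    have h2 : r ^ 2 * Real.exp (-r) ≤ r ^ 2 := by nlinarith [sq_nonneg r]
    have h3' : 0 ≤ r ^ 3 * Real.exp (-r) := by positivity
    have h2' : 0 ≤ r ^ 2 * Real.exp (-r) := by positivity
    rw [abs_le] at hN ⊢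
    constructor <;> linarith [sq_nonneg r]
  rw [kb, abs_div, abs_of_pos (by positivity : 0 < 4 * Real.pi * r ^ 7),
    div_le_div_iff₀ (by positivity) (by positivity)]
  calc _ ≤ 22 * r ^ 2 * r ^ 5 := by gcongr
    _ = 22 * (1 * r ^ 7) := by ring
    _ ≤ _ := by gcongr; linarith

theorem Phi_eq_kh_smul : Phi = fun x => kh ‖x‖ • x := by
  funext x
  rw [Phi, kf, kh, smul_smul, ← div_eq_mul_inv, div_div]
  ring_nf

theorem hasFDerivAt_Phi {x : E3} (hx : x ≠ 0) : HasFDerivAt Phi (radialFDeriv kh ka x) x := by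
  rw [Phi_eq_kh_smul]
  exact hasFDerivAt_radial hx (hasDerivAt_kh (norm_pos_iff.2 hx))

theorem exists_hasFDerivAt_fderiv_Phi {x : E3} (hx : x ≠ 0) :
    ∃ D : E3 →L[ℝ] E3 →L[ℝ] E3, HasFDerivAt (fderiv ℝ Phi) D x ∧ ‖D‖ ≤ 34 / ‖x‖ ^ 2 := by
  have hr : 0 < ‖x‖ := norm_pos_iff.2 hx
  obtain ⟨D, hD, hle⟩ := exists_hasFDerivAt_radialFDeriv hx (hasDerivAt_kh hr) (hasDerivAt_ka hr)
  refine ⟨D, hD.congr_of_eventuallyEq ?_, hle.trans ?_⟩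
  · filter_upwards [isOpen_ne.mem_nhds hx] with y hy using (hasFDerivAt_Phi hy).fderiv
  · calc _ ≤ 3 * (4 / ‖x‖ ^ 3) * ‖x‖ + 22 / ‖x‖ ^ 5 * ‖x‖ ^ 3 := by
          gcongr
          · exact abs_ka_le hr
          · exact abs_kb_le hr
      _ = _ := by field_simp; norm_num

/-- `Φ` is twice differentiable away from the origin with
`‖D²Φ(x)‖ ≤ C(1 + 1/|x|²)`. -/
theorem Phi_second_deriv_bound :
    (∀ x : E3, x ≠ 0 →
        DifferentiableAt ℝ Phi x ∧ DifferentiableAt ℝ (fderiv ℝ Phi) x) ∧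
      ∃ C : ℝ, 0 < C ∧
        ∀ x : E3, x ≠ 0 →
          ‖fderiv ℝ (fderiv ℝ Phi) x‖ ≤ C * (1 + 1 / ‖x‖ ^ 2) := by
  refine ⟨fun x hx => ?_, 34, by norm_num, fun x hx => ?_⟩
  · obtain ⟨D, hD, -⟩ := exists_hasFDerivAt_fderiv_Phi hx
    exact ⟨(hasFDerivAt_Phi hx).differentiableAt, hD.differentiableAt⟩
  · obtain ⟨D, hD, hle⟩ := exists_hasFDerivAt_fderiv_Phi hx
    rw [hD.fderiv]
    refine hle.trans ?_
    rw [mul_add, mul_one_div]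
    linarith

end
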